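/- arXiv:2011.13496 — 4 statements merged into one kernel-verified Lean document; each statement's English description precedes it below -/
import Mathlib

section
/- Consider the two-sample testing problem with alternative parameters ε = ε_n ∈ (0,1/2) and μ = μ_n > 0 possibly varying with n, and let (l_n) be a divergent sequence of positive integers. If there exists a sequence (t_n) of reals such that m \bar F(t_n) → 0 and n ε_n \bar F(t_n − μ_n) ≥ 2 l_n for all large n, then the tail-run test that rejects when L* ≥ l_n is asymptotically powerful: P_{H0}(L* ≥ l_n) → 0 and P_{H1}(L* ≥ l_n) → 1 as n → ∞. -/
open MeasureTheory ProbabilityTheory Filter Set Topology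

/-- The tail-run statistic L*: the number of Y-observations larger than every
X-observation, i.e. the length of the initial run of Y's among the largest
observations of the pooled sample (with probability one all observations are
distinct). -/
noncomputable def tailRun {m n : ℕ} (x : Fin m → ℝ) (y : Fin n → ℝ) : ℕ :=
  (Finset.univ.filter fun j : Fin n => ∀ i : Fin m, x i < y j).card

lemma strictMax_le (P : Measure ℝ) [IsProbabilityMeasure P] (m : ℕ) :
    ((m : ENNReal) + 1) * ((Measure.pi fun _ : Fin m => P).prod P)
      {p | ∀ i, p.1 i < p.2} ≤ 1 := by
  set B : Set (ℝ × (Fin m → ℝ)) := {p | ∀ i, p.2 i < p.1} with hB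
  have hBm : MeasurableSet B := by
    rw [hB, Set.setOf_forall]
    exact MeasurableSet.iInter fun i =>
      measurableSet_lt ((measurable_pi_apply i).comp measurable_snd) measurable_fst
  have hswap : ((Measure.pi fun _ : Fin m => P).prod P) {p | ∀ i, p.1 i < p.2}
      = (P.prod (Measure.pi fun _ : Fin m => P)) B := by
    rw [← (Measure.measurePreserving_swap (μ := Measure.pi fun _ : Fin m => P)
      (ν := P)).measure_preimage hBm.nullMeasurableSet]
    rfl
  rw [hswap]
  let A : Fin (m+1) → Set (Fin (m+1) → ℝ) := fun i =>
    (MeasurableEquiv.piFinSuccAbove (fun _ => ℝ) i) ⁻¹' B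
  have hA : ∀ i, (Measure.pi fun _ : Fin (m+1) => P) (A i)
      = (P.prod (Measure.pi fun _ : Fin m => P)) B := fun i =>
    (measurePreserving_piFinSuccAbove (fun _ : Fin (m+1) => P) i).measure_preimage
      hBm.nullMeasurableSet
  have hAm : ∀ i, MeasurableSet (A i) := fun i =>
    (MeasurableEquiv.piFinSuccAbove (fun _ => ℝ) i).measurable hBm
  have hAlt : ∀ i j z, z ∈ A i → j ≠ i → z j < z i := by
    intro i j z hz hji
    obtain ⟨k, rfl⟩ := Fin.exists_succAbove_eq hji
    exact hz k
  have hd : Pairwise (Function.onFun Disjoint A) := by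
    intro i j hij
    refine Set.disjoint_left.2 fun z hi hj => ?_
    exact lt_asymm (hAlt i j z hi hij.symm) (hAlt j i z hj hij)
  have h1 := measure_iUnion (μ := Measure.pi fun _ : Fin (m+1) => P) hd hAm
  rw [tsum_fintype] at h1
  simp only [hA, Finset.sum_const, Finset.card_univ, Fintype.card_fin, nsmul_eq_mul] at h1
  push_cast at h1
  rw [← h1]
  exact prob_le_one

lemma null_bound (P : Measure ℝ) [IsProbabilityMeasure P] (m n l : ℕ) (h : n ≤ m) :
    (l : ENNReal) * ((Measure.pi fun _ : Fin m => P).prod (Measure.pi fun _ : Fin n => P))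
        {ω | l ≤ tailRun ω.1 ω.2} ≤ 1 := by
  set M := (Measure.pi fun _ : Fin m => P).prod (Measure.pi fun _ : Fin n => P) with hM
  let S : Fin n → Set ((Fin m → ℝ) × (Fin n → ℝ)) := fun j => {ω | ∀ i, ω.1 i < ω.2 j}
  have hSm : ∀ j, MeasurableSet (S j) := by
    intro j
    simp only [S]
    rw [Set.setOf_forall]
    exact MeasurableSet.iInter fun i =>
      measurableSet_lt ((measurable_pi_apply i).comp measurable_fst)
        ((measurable_pi_apply j).comp measurable_snd)
  have hB : MeasurableSet {p : (Fin m → ℝ) × ℝ | ∀ i, p.1 i < p.2} := by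
    rw [Set.setOf_forall]
    exact MeasurableSet.iInter fun i =>
      measurableSet_lt ((measurable_pi_apply i).comp measurable_fst) measurable_snd
  have hS : ∀ j, M (S j) = ((Measure.pi fun _ : Fin m => P).prod P) {p | ∀ i, p.1 i < p.2} := by
    intro j
    have := ((MeasurePreserving.id (Measure.pi fun _ : Fin m => P)).prod
      (measurePreserving_eval (fun _ : Fin n => P) j)).measure_preimage hB.nullMeasurableSet
    exact this
  have hf : ∀ ω : (Fin m → ℝ) × (Fin n → ℝ), ((tailRun ω.1 ω.2 : ℕ) : ENNReal)
      = ∑ j, (S j).indicator (fun _ => (1 : ENNReal)) ω := by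
    intro ω
    simp [tailRun, S, Set.indicator_apply, Finset.sum_ite]
  have hmk := mul_meas_ge_le_lintegral (μ := M)
    (f := fun ω => ∑ j, (S j).indicator (fun _ => (1 : ENNReal)) ω)
    (Finset.measurable_fun_sum _ fun j _ => measurable_const.indicator (hSm j)) (l : ENNReal)
  have hset : {ω : (Fin m → ℝ) × (Fin n → ℝ) | l ≤ tailRun ω.1 ω.2}
      = {ω | (l : ENNReal) ≤ ∑ j, (S j).indicator (fun _ => (1 : ENNReal)) ω} := by
    ext ω
    simp only [Set.mem_setOf_eq]
    rw [← hf]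
    exact Nat.cast_le.symm
  rw [hset]
  refine hmk.trans ?_
  rw [lintegral_finsetSum _ fun j _ => measurable_const.indicator (hSm j)]
  simp only [lintegral_indicator_const (hSm _), hS, one_mul, Finset.sum_const, Finset.card_univ,
    Fintype.card_fin, nsmul_eq_mul]
  refine le_trans ?_ (strictMax_le P m)
  gcongr
  exact (Nat.cast_le.2 h).trans le_self_add

lemma cheb (Q : Measure ℝ) [IsProbabilityMeasure Q] (n l : ℕ) (hl : 0 < l) (t : ℝ)
    (h : 2 * (l : ℝ) ≤ n * Q.real (Ioi t)) :
    (Measure.pi fun _ : Fin n => Q).real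
      {y | (Finset.univ.filter fun j : Fin n => t < y j).card < l} ≤ 2 / l := by
  set p := Q.real (Ioi t) with hp
  set M := Measure.pi fun _ : Fin n => Q with hM
  let g : ℝ → ℝ := (Ioi t).indicator (fun _ => 1)
  have hgm : Measurable g := measurable_const.indicator measurableSet_Ioi
  have hg : MemLp g 2 Q := memLp_indicator_const 2 measurableSet_Ioi 1 (by simp)
  have hl' : (0 : ℝ) < l := by exact_mod_cast hl
  have hgint : ∫ x, g x ∂Q = p := by
    simp [g, integral_indicator_const, measurableSet_Ioi, hp]
  have hvar : variance g Q ≤ p := by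
    refine (variance_le_expectation_sq hgm.aestronglyMeasurable).trans ?_
    rw [← hgint]
    refine le_of_eq (integral_congr_ae (ae_of_all _ fun x => ?_))
    by_cases hx : t < x <;> simp [g, hx]
  let X : (Fin n → ℝ) → ℝ := ∑ i : Fin n, fun ω => g (ω i)
  have hmp : ∀ i : Fin n, MeasurePreserving (Function.eval i) M Q :=
    fun i => measurePreserving_eval (fun _ : Fin n => Q) i
  have hgi : ∀ i : Fin n, MemLp (fun ω : Fin n → ℝ => g (ω i)) 2 M :=
    fun i => hg.comp_measurePreserving (hmp i)
  have hX : MemLp X 2 M := memLp_finsetSum' _ fun i _ => hgi i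
  have hVX : variance X M ≤ n * p := by
    have := variance_sum_pi (μ := fun _ : Fin n => Q) (X := fun _ => g) (fun _ => hg)
    rw [show variance X M = _ from this]
    simp only [Finset.sum_const, Finset.card_univ, Fintype.card_fin, nsmul_eq_mul]
    gcongr
  have hEX : ∫ ω, X ω ∂M = n * p := by
    simp only [X, Finset.sum_apply]
    rw [integral_finsetSum _ fun i _ => (hgi i).integrable (by norm_num)]
    have : ∀ i : Fin n, ∫ ω : Fin n → ℝ, g (ω i) ∂M = p := by
      intro i
      rw [← hgint, ← (hmp i).map_eq]
      exact (integral_map (hmp i).measurable.aemeasurable hgm.aestronglyMeasurable).symm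
    simp [this]
  have hXc : ∀ y, X y = ((Finset.univ.filter fun j : Fin n => t < y j).card : ℝ) := by
    intro y
    simp [X, g, Set.indicator_apply, Finset.sum_ite]
  have hnp : 0 < n * p := by linarith
  have hch := meas_ge_le_variance_div_sq hX (c := n * p / 2) (by linarith)
  have hsub : {y : Fin n → ℝ | (Finset.univ.filter fun j : Fin n => t < y j).card < l}
      ⊆ {ω | n * p / 2 ≤ |X ω - ∫ ω, X ω ∂M|} := by
    intro y hy
    simp only [Set.mem_setOf_eq] at hy ⊢
    have hy' : X y < l := by rw [hXc]; exact_mod_cast hy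
    rw [hEX, abs_sub_comm]
    refine le_trans ?_ (le_abs_self _)
    linarith
  have h1 : M.real {y | (Finset.univ.filter fun j : Fin n => t < y j).card < l}
      ≤ variance X M / (n * p / 2) ^ 2 :=
    ENNReal.toReal_le_of_le_ofReal (div_nonneg (variance_nonneg _ _) (sq_nonneg _))
      ((measure_mono hsub).trans hch)
  refine h1.trans ?_
  rw [div_le_div_iff₀ (by positivity) hl']
  nlinarith [mul_le_mul_of_nonneg_right hVX hl'.le, mul_le_mul_of_nonneg_left h hnp.le]

lemma xmax (P : Measure ℝ) [IsProbabilityMeasure P] (m : ℕ) (t : ℝ) :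
    (Measure.pi fun _ : Fin m => P).real {x | ∃ i, t < x i} ≤ m * P.real (Ioi t) := by
  have : {x : Fin m → ℝ | ∃ i, t < x i} = ⋃ i, (Function.eval i) ⁻¹' (Ioi t) := by
    ext; simp
  rw [this]
  refine (measureReal_iUnion_fintype_le _).trans ?_
  have h : ∀ i : Fin m, (Measure.pi fun _ : Fin m => P).real ((Function.eval i) ⁻¹' (Ioi t))
      = P.real (Ioi t) := fun i => by
    simp only [measureReal_def]
    rw [(measurePreserving_eval (fun _ : Fin m => P) i).measure_preimage
      measurableSet_Ioi.nullMeasurableSet]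
  simp [h]

lemma alt_bound (P Q : Measure ℝ) [IsProbabilityMeasure P] [IsProbabilityMeasure Q]
    (m n l : ℕ) (hl : 0 < l) (t : ℝ) (h : 2 * (l : ℝ) ≤ n * Q.real (Ioi t)) :
    1 - (m * P.real (Ioi t) + 2 / l) ≤
    ((Measure.pi fun _ : Fin m => P).prod (Measure.pi fun _ : Fin n => Q)).real
        {ω | l ≤ tailRun ω.1 ω.2} := by
  set M := (Measure.pi fun _ : Fin m => P).prod (Measure.pi fun _ : Fin n => Q) with hM
  let A : Set (Fin m → ℝ) := {x | ∃ i, t < x i}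
  let B : Set (Fin n → ℝ) := {y | (Finset.univ.filter fun j : Fin n => t < y j).card < l}
  have hcov : (univ : Set ((Fin m → ℝ) × (Fin n → ℝ))) ⊆
      (A ×ˢ univ ∪ univ ×ˢ B) ∪ {ω | l ≤ tailRun ω.1 ω.2} := by
    rintro ⟨x, y⟩ -
    by_cases hx : x ∈ A
    · left; left; exact ⟨hx, trivial⟩
    by_cases hy : y ∈ B
    · left; right; exact ⟨trivial, hy⟩
    right
    simp only [A, B, Set.mem_setOf_eq, not_exists, not_lt] at hx hy ⊢
    refine hy.trans (Finset.card_le_card ?_)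
    intro j hj
    simp only [Finset.mem_filter, Finset.mem_univ, true_and] at hj ⊢
    exact fun i => (hx i).trans_lt hj
  have h1 : M.real univ ≤ _ := measureReal_mono hcov
  have h2 := measureReal_union_le (μ := M) (A ×ˢ univ ∪ univ ×ˢ B) {ω | l ≤ tailRun ω.1 ω.2}
  have h3 := measureReal_union_le (μ := M) (A ×ˢ univ) (univ ×ˢ B)
  have h4 : M.real (A ×ˢ univ) ≤ m * P.real (Ioi t) := by
    rw [hM, measureReal_prod_prod]
    simpa using xmax P m t
  have h5 : M.real (univ ×ˢ B) ≤ 2 / l := by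
    rw [hM, measureReal_prod_prod]
    simpa using cheb Q n l hl t h
  have h6 : M.real univ = 1 := by simp
  linarith

/-- In the two-sample problem, if (l_n) is a divergent sequence of
positive integers and there is a sequence (t_n) with `m F̄(t_n) → 0` and
`n ε_n F̄(t_n − μ_n) ≥ 2 l_n` for all large n, then the tail-run test rejecting
when L* ≥ l_n is asymptotically powerful: P_{H0}(L* ≥ l_n) → 0 and
P_{H1}(L* ≥ l_n) → 1. -/
theorem stmt_6
    (P : Measure ℝ) [IsProbabilityMeasure P]
    (F : ℝ → ℝ) (hF : ∀ t, F t = (P (Set.Iic t)).toReal) (hFcont : Continuous F)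
    (ε μ : ℕ → ℝ) (hε : ∀ n, ε n ∈ Set.Ioo (0:ℝ) (1/2)) (hμ : ∀ n, 0 < μ n)
    (η : ℝ) (hη : η ∈ Set.Ioc (0:ℝ) (1/2))
    (m : ℕ → ℕ) (hmn : ∀ᶠ n in atTop, n ≤ m n)
    (hcouple : (fun n : ℕ => (n : ℝ) / ((m n : ℝ) + n) - η)
      =O[atTop] fun n => Real.log n / Real.sqrt n)
    (Q : ℕ → Measure ℝ) [∀ n, IsProbabilityMeasure (Q n)]
    (hQ : ∀ n, Q n = ENNReal.ofReal (1 - ε n) • P + ENNReal.ofReal (ε n) • P.map (· + μ n))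
    (l : ℕ → ℕ) (hlpos : ∀ n, 0 < l n) (hl : Tendsto l atTop atTop)
    (t : ℕ → ℝ)
    (ht1 : Tendsto (fun n : ℕ => (m n : ℝ) * (1 - F (t n))) atTop (𝓝 0))
    (ht2 : ∀ᶠ n in atTop, 2 * (l n : ℝ) ≤ (n : ℝ) * ε n * (1 - F (t n - μ n))) :
    Tendsto (fun n => (((Measure.pi fun _ : Fin (m n) => P).prod
        (Measure.pi fun _ : Fin n => P))
        {ω | l n ≤ tailRun ω.1 ω.2}).toReal) atTop (𝓝 0) ∧
    Tendsto (fun n => (((Measure.pi fun _ : Fin (m n) => P).prod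
        (Measure.pi fun _ : Fin n => Q n))
        {ω | l n ≤ tailRun ω.1 ω.2}).toReal) atTop (𝓝 1) := by
  have hbar : ∀ s, P.real (Ioi s) = 1 - F s := by
    intro s
    rw [← Set.compl_Iic, probReal_compl_eq_one_sub measurableSet_Iic, hF]
    rfl
  have hlR : Tendsto (fun n => (l n : ℝ)) atTop atTop := tendsto_natCast_atTop_atTop.comp hl
  constructor
  · refine tendsto_of_tendsto_of_tendsto_of_le_of_le' tendsto_const_nhds
      hlR.inv_tendsto_atTop (Eventually.of_forall fun n => ENNReal.toReal_nonneg) ?_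
    filter_upwards [hmn] with n hn
    have h := ENNReal.toReal_mono ENNReal.one_ne_top (null_bound P (m n) n (l n) hn)
    rw [ENNReal.toReal_mul, ENNReal.toReal_natCast, ENNReal.toReal_one] at h
    have h0 : (0 : ℝ) < l n := by exact_mod_cast hlpos n
    simp only [Pi.inv_apply]
    rw [← one_div, le_div_iff₀ h0, mul_comm]
    exact h
  · have hlim : Tendsto (fun n => 1 - ((m n : ℝ) * P.real (Ioi (t n)) + 2 / (l n : ℝ)))
        atTop (𝓝 1) := by
      simp only [hbar]
      have := (ht1.add (hlR.const_div_atTop 2)).const_sub 1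
      simpa using this
    refine tendsto_of_tendsto_of_tendsto_of_le_of_le' hlim tendsto_const_nhds ?_
      (Eventually.of_forall fun n => measureReal_le_one)
    filter_upwards [ht2] with n hn
    refine alt_bound P (Q n) (m n) n (l n) (hlpos n) (t n) (hn.trans ?_)
    rw [mul_assoc]
    refine mul_le_mul_of_nonneg_left ?_ (Nat.cast_nonneg n)
    have hpre : (fun x : ℝ => x + μ n) ⁻¹' (Ioi (t n)) = Ioi (t n - μ n) := by
      ext x; simp [sub_lt_iff_lt_add]
    have hle : ENNReal.ofReal (ε n) * P (Ioi (t n - μ n)) ≤ Q n (Ioi (t n)) := by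
      have e := congrArg (fun ν : Measure ℝ => ν (Ioi (t n))) (hQ n)
      simp only [Measure.add_apply, Measure.smul_apply, smul_eq_mul] at e
      rw [e, Measure.map_apply (by fun_prop) measurableSet_Ioi, hpre]
      exact le_add_self
    have h := ENNReal.toReal_mono (measure_ne_top _ _) hle
    rw [ENNReal.toReal_mul, ENNReal.toReal_ofReal (hε n).1.le] at h
    rw [← hbar]
    exact h
end

section
/- Let Z_1,…,Z_{m+n} be i.i.d. with a continuous CDF F, where the first m observations are labeled X's and the last n are labeled Y's, and let L* = max{l ≥ 0 : the l largest observations among Z_1,…,Z_{m+n} are all Y's}. Then L* follows the negative hypergeometric distribution with E[L*] = n/(m+1) and Var(L*) = ((m+n+1)n/((m+1)(m+2))) · (1 − 1/(m+1)). -/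
open MeasureTheory ProbabilityTheory Filter Set

/-- The tail-run statistic for a pooled sample `z : Fin (m+n) → ℝ`, where the
first `m` coordinates are the X-observations and the last `n` coordinates are
the Y-observations: the number of Y-observations exceeding every X-observation
(with probability one all observations are distinct, so this is the length of
the initial run of Y's among the largest observations). -/
noncomputable def tailRunPooled (m n : ℕ) (z : Fin (m + n) → ℝ) : ℕ :=
  (Finset.univ.filter fun j : Fin n =>
    ∀ i : Fin m, z (Fin.castAdd n i) < z (Fin.natAdd m j)).card


lemma tr_noAtoms (P : Measure ℝ) [IsProbabilityMeasure P]
    (hPcont : Continuous fun t => (P (Set.Iic t)).toReal) : NullSingletonClass P := by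
  constructor
  intro x
  have h1 : ∀ y < x, (P {x}).toReal ≤ (P (Set.Iic x)).toReal - (P (Set.Iic y)).toReal := by
    intro y hy
    have h2 : P (Set.Iic y ∪ {x}) = P (Set.Iic y) + P {x} :=
      measure_union (by simpa using hy) (measurableSet_singleton x)
    have h3 : P (Set.Iic y ∪ {x}) ≤ P (Set.Iic x) := by
      apply measure_mono
      rintro z (hz | hz)
      · exact le_trans hz hy.le
      · exact le_of_eq hz
    have h4 := ENNReal.toReal_mono (measure_ne_top _ _) h3
    rw [h2, ENNReal.toReal_add (measure_ne_top _ _) (measure_ne_top _ _)] at h4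
    linarith
  have h5 : Tendsto (fun y => (P (Set.Iic x)).toReal - (P (Set.Iic y)).toReal)
      (nhdsWithin x (Set.Iio x)) (nhds ((P (Set.Iic x)).toReal - (P (Set.Iic x)).toReal)) :=
    ((continuous_const.sub hPcont).tendsto x).mono_left nhdsWithin_le_nhds
  have h6 := ge_of_tendsto h5 (eventually_nhdsWithin_of_forall h1)
  rw [sub_self] at h6
  have h7 : (P {x}).toReal = 0 := le_antisymm h6 ENNReal.toReal_nonneg
  exact (ENNReal.toReal_eq_zero_iff _).1 h7 |>.resolve_right (measure_ne_top _ _)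

lemma tr_inj (N : ℕ) (P : Measure ℝ) [IsProbabilityMeasure P] [NullSingletonClass P] :
    ∀ᵐ z ∂(Measure.pi fun _ : Fin N => P), Function.Injective z := by
  have h : ∀ i j : Fin N, i ≠ j → ∀ᵐ z ∂(Measure.pi fun _ : Fin N => P), z i ≠ z j := by
    intro i j hij
    have hind : IndepFun (fun z : Fin N → ℝ => z i) (fun z => z j)
        (Measure.pi fun _ : Fin N => P) :=
      (iIndepFun_pi (μ := fun _ : Fin N => P) (X := fun _ => (id : ℝ → ℝ))
        (fun _ => aemeasurable_id)).indepFun hij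
    rw [indepFun_iff_map_prod_eq_prod_map_map (measurable_pi_apply i).aemeasurable
      (measurable_pi_apply j).aemeasurable] at hind
    have e1 : ∀ k : Fin N, Measure.map (fun z : Fin N → ℝ => z k)
        (Measure.pi fun _ : Fin N => P) = P :=
      fun k => (measurePreserving_eval (fun _ : Fin N => P) k).map_eq
    rw [e1, e1] at hind
    have hm : MeasurableSet {p : ℝ × ℝ | p.1 = p.2} :=
      measurableSet_eq_fun measurable_fst measurable_snd
    have hd : (P.prod P) {p : ℝ × ℝ | p.1 = p.2} = 0 := by
      rw [Measure.measure_prod_null hm]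
      refine Eventually.of_forall fun x => ?_
      have : (Prod.mk x ⁻¹' {p : ℝ × ℝ | p.1 = p.2}) = {x} := by
        ext y; simp [eq_comm]
      simp [this]
    rw [← hind, Measure.map_apply
      ((measurable_pi_apply i).prodMk (measurable_pi_apply j)) hm] at hd
    rw [ae_iff]
    simpa using hd
  have h' : ∀ᵐ z ∂(Measure.pi fun _ : Fin N => P), ∀ i j : Fin N, i ≠ j → z i ≠ z j := by
    rw [ae_all_iff]; intro i
    rw [ae_all_iff]; intro j
    by_cases hij : i = j
    · simp [hij]
    · filter_upwards [h i j hij] with z hz _ using hz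
  filter_upwards [h'] with z hz i j hij
  by_contra hne
  exact hz i j hne hij

def trTop {N : ℕ} (S : Finset (Fin N)) : Set (Fin N → ℝ) :=
  {z | ∀ s ∈ S, ∀ i, i ∉ S → z i < z s}

lemma tr_meas {N : ℕ} (S : Finset (Fin N)) : MeasurableSet (trTop S) := by
  have : trTop S = ⋂ s, ⋂ (_ : s ∈ S), ⋂ i, ⋂ (_ : i ∉ S), {z : Fin N → ℝ | z i < z s} := by
    ext z; simp [trTop]
  rw [this]
  refine MeasurableSet.iInter fun s => MeasurableSet.iInter fun _ =>
    MeasurableSet.iInter fun i => MeasurableSet.iInter fun _ =>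
    measurableSet_lt (measurable_pi_apply i) (measurable_pi_apply s)

lemma tr_perm {N : ℕ} (P : Measure ℝ) [IsProbabilityMeasure P] (S T : Finset (Fin N))
    (h : S.card = T.card) :
    (Measure.pi fun _ : Fin N => P) (trTop S) = (Measure.pi fun _ : Fin N => P) (trTop T) := by
  obtain ⟨σ, hσ⟩ := Equiv.Perm.exists_map_finset_eq S T h
  have hp := measurePreserving_piCongrLeft (fun _ : Fin N => P) σ
  rw [← hp.measure_preimage (tr_meas T).nullMeasurableSet]
  congr 1
  ext z
  have hz : ∀ i, (MeasurableEquiv.piCongrLeft (fun _ : Fin N => ℝ) σ) z (σ i) = z i := by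
    intro i
    exact Equiv.piCongrLeft_apply_apply (fun _ : Fin N => ℝ) σ z i
  have hm : ∀ i, σ i ∈ T ↔ i ∈ S := by
    intro i; rw [← hσ]; simp
  simp only [trTop, Set.mem_ofPred_eq, Set.mem_preimage]
  constructor
  · intro H s hs i hi
    obtain ⟨s, rfl⟩ := σ.surjective s
    obtain ⟨i, rfl⟩ := σ.surjective i
    rw [hz, hz]
    exact H s ((hm s).1 hs) i (fun h => hi ((hm i).2 h))
  · intro H s hs i hi
    have := H (σ s) ((hm s).2 hs) (σ i) (fun h => hi ((hm i).1 h))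
    rwa [hz, hz] at this

lemma tr_disj {N : ℕ} (S T : Finset (Fin N)) (h : S.card = T.card) (hne : S ≠ T) :
    Disjoint (trTop S) (trTop T) := by
  rw [Set.disjoint_left]
  intro z hS hT
  have h1 : ¬ S ⊆ T := fun hs => hne (Finset.eq_of_subset_of_card_le hs h.ge)
  have h2 : ¬ T ⊆ S := fun hs => hne (Finset.eq_of_subset_of_card_le hs h.le).symm
  obtain ⟨a, ha, ha'⟩ := Finset.not_subset.1 h1
  obtain ⟨b, hb, hb'⟩ := Finset.not_subset.1 h2
  exact lt_asymm (hS a ha b hb') (hT b hb a ha')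

lemma tr_exists {N : ℕ} (z : Fin N → ℝ) (hz : Function.Injective z) (l : ℕ) (hl : l ≤ N) :
    ∃ S : Finset (Fin N), S.card = l ∧ z ∈ trTop S := by
  induction l with
  | zero => exact ⟨∅, rfl, by simp [trTop]⟩
  | succ l ih =>
    obtain ⟨S, hc, hS⟩ := ih (by omega)
    have hne : (Sᶜ).Nonempty := by
      rw [← Finset.card_pos, Finset.card_compl, Fintype.card_fin]; omega
    obtain ⟨a, ha, hmax⟩ := Finset.exists_max_image Sᶜ z hne
    rw [Finset.mem_compl] at ha
    refine ⟨insert a S, by rw [Finset.card_insert_of_notMem ha, hc], ?_⟩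
    intro s hs i hi
    rw [Finset.mem_insert, not_or] at hi
    rcases Finset.mem_insert.1 hs with rfl | hs
    · exact lt_of_le_of_ne (hmax i (Finset.mem_compl.2 hi.2)) (fun h => hi.1 (hz h))
    · exact hS s hs i hi.2

lemma tr_iff (m n l : ℕ) (hl : l ≤ m + n) (z : Fin (m + n) → ℝ) (hz : Function.Injective z) :
    l ≤ tailRunPooled m n z ↔
      ∃ S ∈ Finset.powersetCard l (Finset.univ.map (Fin.natAddEmb m (m := n))), z ∈ trTop S := by
  constructor
  · intro h
    obtain ⟨S, hc, hS⟩ := tr_exists z hz l hl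
    refine ⟨S, Finset.mem_powersetCard.2 ⟨?_, hc⟩, hS⟩
    intro x hx
    induction x using Fin.addCases with
    | right j => simp
    | left i =>
      exfalso
      unfold tailRunPooled at h
      set T := (Finset.univ.filter fun j : Fin n =>
        ∀ i : Fin m, z (Fin.castAdd n i) < z (Fin.natAdd m j)) with hT
      have hsub : insert (Fin.castAdd n i) (T.map (Fin.natAddEmb m)) ⊆ S := by
        intro y hy
        rcases Finset.mem_insert.1 hy with rfl | hy
        · exact hx
        · obtain ⟨j, hj, rfl⟩ := Finset.mem_map.1 hy
          by_contra hn
          have h1 := hS _ hx _ hn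
          have h2 := (Finset.mem_filter.1 hj).2 i
          exact lt_asymm h1 h2
      have := Finset.card_le_card hsub
      rw [Finset.card_insert_of_notMem, Finset.card_map] at this
      · omega
      · intro hmem
        obtain ⟨j, hj, hj'⟩ := Finset.mem_map.1 hmem
        have := congrArg Fin.val hj'
        have hi := i.2
        simp at this
        omega
  · rintro ⟨S, hS, hz⟩
    obtain ⟨hsub, hc⟩ := Finset.mem_powersetCard.1 hS
    unfold tailRunPooled
    rw [← hc, ← Finset.card_map (s := Finset.univ.filter _) (Fin.natAddEmb m)]
    apply Finset.card_le_card
    intro s hs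
    obtain ⟨j, -, rfl⟩ := Finset.mem_map.1 (hsub hs)
    refine Finset.mem_map_of_mem _ (Finset.mem_filter.2 ⟨Finset.mem_univ _, fun i => ?_⟩)
    refine hz _ hs _ fun hmem => ?_
    obtain ⟨k, -, hk⟩ := Finset.mem_map.1 (hsub hmem)
    have := congrArg Fin.val hk
    have hi := i.2
    simp at this
    omega

lemma tr_sum {N : ℕ} (P : Measure ℝ) [IsProbabilityMeasure P] (l : ℕ) (Y : Finset (Fin N))
    (S₀ : Finset (Fin N)) (h₀ : S₀.card = l) :
    (Measure.pi fun _ : Fin N => P) (⋃ S ∈ Finset.powersetCard l Y, trTop S)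
      = (Y.card.choose l : ENNReal) * (Measure.pi fun _ : Fin N => P) (trTop S₀) := by
  rw [measure_biUnion_finset]
  · rw [Finset.sum_congr rfl (g := fun _ => (Measure.pi fun _ : Fin N => P) (trTop S₀))]
    · simp [Finset.card_powersetCard]
    · intro S hS
      exact tr_perm P S S₀ ((Finset.mem_powersetCard.1 hS).2.trans h₀.symm)
  · intro S hS T hT hne
    exact tr_disj S T ((Finset.mem_powersetCard.1 hS).2.trans
      (Finset.mem_powersetCard.1 hT).2.symm) hne
  · intro S _; exact tr_meas S

lemma tr_le (m n : ℕ) (z : Fin (m + n) → ℝ) : tailRunPooled m n z ≤ n := by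
  unfold tailRunPooled
  exact (Finset.card_filter_le _ _).trans (by simp)

lemma tr_tail (m n : ℕ) (P : Measure ℝ) [IsProbabilityMeasure P] [NullSingletonClass P] (l : ℕ) :
    ((Measure.pi fun _ : Fin (m + n) => P) {z | l ≤ tailRunPooled m n z}).toReal
        = (n.descFactorial l : ℝ) / ((m + n).descFactorial l : ℝ) := by
  by_cases hl : l ≤ m + n
  · obtain ⟨S₀, -, h₀⟩ := Finset.exists_subset_card_eq
      (s := (Finset.univ : Finset (Fin (m + n)))) (n := l) (by simpa using hl)
    have e1 : (Measure.pi fun _ : Fin (m + n) => P) {z | l ≤ tailRunPooled m n z}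
        = (n.choose l : ENNReal) * (Measure.pi fun _ : Fin (m + n) => P) (trTop S₀) := by
      have := tr_sum P l (Finset.univ.map (Fin.natAddEmb m (m := n))) S₀ h₀
      rw [Finset.card_map, Finset.card_univ, Fintype.card_fin] at this
      rw [← this]
      apply measure_congr
      filter_upwards [tr_inj (m + n) P] with z hz
      apply propext
      refine (tr_iff m n l hl z hz).trans ?_
      exact (by simp only [Set.mem_iUnion, exists_prop] :
        z ∈ (⋃ S ∈ Finset.powersetCard l (Finset.univ.map (Fin.natAddEmb m (m := n))), trTop S)
        ↔ _).symm
    have e2 : (1 : ENNReal) = ((m + n).choose l : ENNReal)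
        * (Measure.pi fun _ : Fin (m + n) => P) (trTop S₀) := by
      have := tr_sum P l (Finset.univ : Finset (Fin (m + n))) S₀ h₀
      rw [Finset.card_univ, Fintype.card_fin] at this
      rw [← this, ← measure_univ (μ := Measure.pi fun _ : Fin (m + n) => P)]
      apply measure_congr
      filter_upwards [tr_inj (m + n) P] with z hz
      apply propext
      obtain ⟨S, hc, hS⟩ := tr_exists z hz l hl
      refine iff_of_true trivial ?_
      exact Set.mem_biUnion (Finset.mem_powersetCard.2 ⟨Finset.subset_univ _, hc⟩) hS
    have e2' := congrArg ENNReal.toReal e2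
    rw [e1]
    simp only [ENNReal.toReal_mul, ENNReal.toReal_natCast, ENNReal.toReal_one] at e2' ⊢
    rw [Nat.descFactorial_eq_factorial_mul_choose, Nat.descFactorial_eq_factorial_mul_choose]
    have hf : (l.factorial : ℝ) ≠ 0 := by exact_mod_cast l.factorial_ne_zero
    have hc : ((m + n).choose l : ℝ) ≠ 0 := by exact_mod_cast (Nat.choose_pos hl).ne'
    push_cast
    rw [mul_div_mul_left _ _ hf, eq_div_iff hc, mul_assoc, mul_comm _ ((m + n).choose l : ℝ),
      ← e2', mul_one]
  · have : {z | l ≤ tailRunPooled m n z} = ∅ := by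
      ext z
      have := tr_le m n z
      simp only [Set.mem_ofPred_eq, Set.mem_empty_iff_false, iff_false]
      omega
    rw [this, Nat.descFactorial_of_lt (by omega : n < l)]
    simp

lemma tr_measT (m n : ℕ) : Measurable (tailRunPooled m n) := by
  have : tailRunPooled m n = fun z => ∑ j : Fin n,
      if (∀ i : Fin m, z (Fin.castAdd n i) < z (Fin.natAdd m j)) then 1 else 0 := by
    ext z; unfold tailRunPooled; rw [Finset.card_filter]
  rw [this]
  refine Finset.measurable_sum _ fun j _ => Measurable.ite ?_ measurable_const measurable_const
  rw [Set.ofPred_forall]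
  exact MeasurableSet.iInter fun i =>
    measurableSet_lt (measurable_pi_apply _) (measurable_pi_apply _)

lemma tr_expand (n k : ℕ) (hk : k ≤ n) (a : ℕ → ℝ) :
    ∑ l ∈ Finset.range n, (if l + 1 ≤ k then a l else 0) = ∑ l ∈ Finset.range k, a l := by
  rw [← Finset.sum_filter]
  congr 1
  ext l; simp; omega

lemma tr_int (m n : ℕ) (P : Measure ℝ) [IsProbabilityMeasure P] [NullSingletonClass P] (a : ℕ → ℝ) :
    ∫ z, (∑ l ∈ Finset.range (tailRunPooled m n z), a l) ∂(Measure.pi fun _ : Fin (m + n) => P)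
      = ∑ l ∈ Finset.range n, a l *
        ((n.descFactorial (l + 1) : ℝ) / ((m + n).descFactorial (l + 1) : ℝ)) := by
  have hms : ∀ l, MeasurableSet {z | l + 1 ≤ tailRunPooled m n z} := fun l =>
    measurableSet_le measurable_const (tr_measT m n)
  have : (fun z => ∑ l ∈ Finset.range (tailRunPooled m n z), a l) = fun z =>
      ∑ l ∈ Finset.range n, Set.indicator {z | l + 1 ≤ tailRunPooled m n z} (fun _ => a l) z := by
    ext z
    rw [← tr_expand n _ (tr_le m n z)]
    refine Finset.sum_congr rfl fun l _ => ?_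
    simp [Set.indicator_apply]
  rw [this, integral_finsetSum]
  · refine Finset.sum_congr rfl fun l _ => ?_
    rw [integral_indicator_const _ (hms l), ← tr_tail m n P (l + 1), smul_eq_mul, mul_comm]
    rfl
  · intro l _
    exact (integrable_const (a l)).indicator (hms l)

lemma tr_rec (m n l : ℕ) (hl : l < n) :
    ((m : ℝ) + n - l) * ((n.descFactorial (l + 1) : ℝ) / ((m + n).descFactorial (l + 1) : ℝ))
      = ((n : ℝ) - l) * ((n.descFactorial l : ℝ) / ((m + n).descFactorial l : ℝ)) := by
  rw [Nat.descFactorial_succ, Nat.descFactorial_succ]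
  have h1 : (((m + n).descFactorial l : ℕ) : ℝ) ≠ 0 := by
    exact_mod_cast (Nat.descFactorial_pos.2 (by omega : l ≤ m + n)).ne'
  have h2 : ((m : ℝ) + n - l) ≠ 0 := by
    have : (l : ℝ) < n := by exact_mod_cast hl
    have : (0 : ℝ) ≤ m := Nat.cast_nonneg m
    intro h; linarith
  push_cast [Nat.cast_sub (by omega : l ≤ m + n), Nat.cast_sub hl.le]
  field_simp

lemma tr_sums (m n : ℕ) (t : ℕ → ℝ) (h0 : t 0 = 1)
    (ht : ∀ l < n, ((m : ℝ) + n - l) * t (l + 1) = ((n : ℝ) - l) * t l) :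
    ∑ l ∈ Finset.range n, t (l + 1) = (n : ℝ) / (m + 1) ∧
    ∑ l ∈ Finset.range n, (l : ℝ) * t (l + 1) = (n : ℝ) * (n - 1) / ((m + 1) * (m + 2)) := by
  have hm1 : (m : ℝ) + 1 ≠ 0 := by positivity
  have hm2 : (m : ℝ) + 2 ≠ 0 := by positivity
  have A : ((m : ℝ) + 1) * ∑ l ∈ Finset.range n, t (l + 1) = n := by
    have := Finset.sum_range_sub' (fun l : ℕ => ((n : ℝ) - l) * t l) n
    simp only [sub_self, zero_mul, sub_zero, h0, mul_one, Nat.cast_zero] at this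
    rw [← this, Finset.mul_sum]
    refine Finset.sum_congr rfl fun l hl => ?_
    rw [← ht l (Finset.mem_range.1 hl)]
    push_cast; ring
  have B : ((m : ℝ) + 2) * ∑ l ∈ Finset.range n, (l : ℝ) * t (l + 1)
      - ((n : ℝ) - 1) * ∑ l ∈ Finset.range n, t (l + 1) = 0 := by
    have := Finset.sum_range_sub' (fun l : ℕ => (l : ℝ) * (((n : ℝ) - l) * t l)) n
    simp only [sub_self, zero_mul, mul_zero, Nat.cast_zero] at this
    rw [← this, Finset.mul_sum, Finset.mul_sum, ← Finset.sum_sub_distrib]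
    refine Finset.sum_congr rfl fun l hl => ?_
    rw [← ht l (Finset.mem_range.1 hl)]
    push_cast; ring
  have A' : ∑ l ∈ Finset.range n, t (l + 1) = (n : ℝ) / (m + 1) := by
    rw [eq_div_iff hm1, mul_comm, A]
  refine ⟨A', ?_⟩
  rw [A'] at B
  rw [eq_div_iff (mul_ne_zero hm1 hm2)]
  field_simp at B
  linarith

lemma tr_sq (k : ℕ) : ∑ l ∈ Finset.range k, (2 * (l : ℝ) + 1) = (k : ℝ) ^ 2 := by
  induction k with
  | zero => simp
  | succ k ih => rw [Finset.sum_range_succ, ih]; push_cast; ring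

/-- If Z₁,…,Z_{m+n} are i.i.d. with continuous CDF F, the first m
labeled X and the last n labeled Y, then L* follows the negative hypergeometric
distribution — P(L* ≥ l) = (n)_l / (m+n)_l for all l — with E[L*] = n/(m+1) and
Var(L*) = ((m+n+1)n/((m+1)(m+2)))·(1 − 1/(m+1)). -/
theorem stmt_10 (m n : ℕ)
    (P : Measure ℝ) [IsProbabilityMeasure P]
    (hPcont : Continuous fun t => (P (Set.Iic t)).toReal) :
    (∀ l : ℕ, (((Measure.pi fun _ : Fin (m + n) => P)
          {z | l ≤ tailRunPooled m n z}).toReal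
        = (n.descFactorial l : ℝ) / ((m + n).descFactorial l : ℝ))) ∧
    (∫ z, (tailRunPooled m n z : ℝ) ∂(Measure.pi fun _ : Fin (m + n) => P))
      = (n : ℝ) / (m + 1) ∧
    variance (fun z => (tailRunPooled m n z : ℝ)) (Measure.pi fun _ : Fin (m + n) => P)
      = (((m : ℝ) + n + 1) * n / (((m : ℝ) + 1) * ((m : ℝ) + 2)))
        * (1 - 1 / ((m : ℝ) + 1)) := by
  have := tr_noAtoms P hPcont
  obtain ⟨s1, s2⟩ := tr_sums m n
    (fun l => (n.descFactorial l : ℝ) / ((m + n).descFactorial l : ℝ)) (by simp)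
    (fun l hl => tr_rec m n l hl)
  have E1 : (∫ z, (tailRunPooled m n z : ℝ) ∂(Measure.pi fun _ : Fin (m + n) => P))
      = (n : ℝ) / (m + 1) := by
    have := tr_int m n P (fun _ => 1)
    simp only [one_mul, Finset.sum_const, Finset.card_range, nsmul_eq_mul, mul_one] at this
    rw [this, s1]
  have E2 : (∫ z, (tailRunPooled m n z : ℝ) ^ 2 ∂(Measure.pi fun _ : Fin (m + n) => P))
      = 2 * ((n : ℝ) * (n - 1) / ((m + 1) * (m + 2))) + (n : ℝ) / (m + 1) := by
    have := tr_int m n P (fun l => 2 * (l : ℝ) + 1)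
    simp only [tr_sq] at this
    rw [this, ← s1, ← s2, Finset.mul_sum, ← Finset.sum_add_distrib]
    refine Finset.sum_congr rfl fun l _ => ?_
    ring
  refine ⟨tr_tail m n P, E1, ?_⟩
  have hmem : MemLp (fun z => (tailRunPooled m n z : ℝ)) 2
      (Measure.pi fun _ : Fin (m + n) => P) := by
    refine MemLp.of_bound
      ((measurable_from_top.comp (tr_measT m n)).aestronglyMeasurable) (n : ℝ) ?_
    refine Eventually.of_forall fun z => ?_
    simpa using tr_le m n z
  rw [variance_eq_sub hmem, E1]
  simp only [Pi.pow_apply]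
  rw [E2]
  have hm1 : (m : ℝ) + 1 ≠ 0 := by positivity
  have hm2 : (m : ℝ) + 2 ≠ 0 := by positivity
  field_simp
  ring
end

section
/- Fix γ > 0 and reals 0 < r < q, and let F_γ be the generalized Gaussian CDF. Set t_n = (γ q log n)^{1/γ} and μ_n = (γ r log n)^{1/γ}. Then log \bar F_γ(t_n) / log n → −q and log \bar F_γ(t_n − μ_n) / log n → −(q^{1/γ} − r^{1/γ})^γ as n → ∞. -/
open MeasureTheory Filter Topology

/-- The survival function of the generalized Gaussian distribution with
density `c * exp(−|x|^γ/γ)`. -/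
noncomputable def ggSurvival (γ c : ℝ) (t : ℝ) : ℝ :=
  ∫ x in Set.Ici t, c * Real.exp (-(|x| ^ γ) / γ)

lemma gg_integrable (γ : ℝ) (hγ : 0 < γ) (b : ℝ) (hb : 0 < b) :
    IntegrableOn (fun x : ℝ => Real.exp (-b * |x| ^ γ)) (Set.Ici 0) := by
  rw [integrableOn_Ici_iff_integrableOn_Ioi]
  have h := integrableOn_rpow_mul_exp_neg_mul_rpow (p := γ) (s := 0) (b := b) (by norm_num) hγ hb
  refine h.congr_fun ?_ measurableSet_Ioi
  intro x hx
  have hx' : (0:ℝ) < x := hx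
  simp [abs_of_pos hx']

lemma gg_integrable' (γ c : ℝ) (hγ : 0 < γ) :
    IntegrableOn (fun x : ℝ => c * Real.exp (-(|x| ^ γ) / γ)) (Set.Ici 0) := by
  have h := (gg_integrable γ hγ (1/γ) (by positivity)).const_mul c
  refine h.congr (ae_of_all _ fun x => ?_)
  show c * Real.exp _ = c * Real.exp _
  congr 2
  ring

lemma gg_pow (γ y : ℝ) (hγ : 0 < γ) (hy : 0 ≤ y) : (y ^ (1/γ)) ^ γ = y := by
  rw [← Real.rpow_mul hy, one_div_mul_cancel hγ.ne', Real.rpow_one]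

lemma gg_lower (γ c a θ : ℝ) (hγ : 0 < γ) (hc : 0 < c) (ha : 0 < a) (hθ : 0 < θ) :
    ∃ K > 0, ∀ L : ℝ, 1 ≤ γ * L →
      K * Real.exp (-(a + θ) * L) ≤ ggSurvival γ c ((γ * a * L) ^ (1/γ)) := by
  have hlt : a ^ (1/γ) < (a + θ) ^ (1/γ) :=
    Real.rpow_lt_rpow ha.le (by linarith) (by positivity)
  refine ⟨c * ((a + θ) ^ (1/γ) - a ^ (1/γ)), mul_pos hc (by linarith), fun L hL => ?_⟩
  have hL0 : 0 < L := by
    by_contra h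
    nlinarith
  set T := (γ * a * L) ^ (1/γ) with hT
  set T' := (γ * (a + θ) * L) ^ (1/γ) with hT'
  have hT0 : 0 ≤ T := by positivity
  have e1 : T = (γ * L) ^ (1/γ) * a ^ (1/γ) := by
    rw [hT, ← Real.mul_rpow (by positivity) ha.le]; congr 1; ring
  have e2 : T' = (γ * L) ^ (1/γ) * (a + θ) ^ (1/γ) := by
    rw [hT', ← Real.mul_rpow (by positivity) (by positivity)]; congr 1; ring
  have hone : 1 ≤ (γ * L) ^ (1/γ) := Real.one_le_rpow hL (by positivity)
  have hw : (a + θ) ^ (1/γ) - a ^ (1/γ) ≤ T' - T := by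
    rw [e1, e2, ← mul_sub]
    exact le_mul_of_one_le_left (by linarith) hone
  have hint := gg_integrable' γ c hγ
  have hsub : Set.Icc T T' ⊆ Set.Ici T := fun x hx => hx.1
  have hsub0 : Set.Ici T ⊆ Set.Ici 0 := Set.Ici_subset_Ici.2 hT0
  unfold ggSurvival
  calc c * ((a + θ) ^ (1/γ) - a ^ (1/γ)) * Real.exp (-(a + θ) * L)
      ≤ (T' - T) * (c * Real.exp (-(a + θ) * L)) := by
        rw [mul_comm c, mul_assoc]
        gcongr
    _ = ∫ x in Set.Icc T T', c * Real.exp (-(a + θ) * L) := by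
        rw [setIntegral_const]
        simp [Measure.real, ENNReal.toReal_ofReal (show 0 ≤ T' - T by linarith)]
    _ ≤ ∫ x in Set.Icc T T', c * Real.exp (-(|x| ^ γ) / γ) := by
        refine setIntegral_mono_on (continuous_const.integrableOn_Icc) (hint.mono_set (hsub.trans hsub0))
          measurableSet_Icc ?_
        intro x hx
        have hx0 : 0 ≤ x := hT0.trans hx.1
        have : |x| ^ γ ≤ γ * (a + θ) * L := by
          rw [abs_of_nonneg hx0, ← gg_pow γ (γ * (a + θ) * L) hγ (by positivity)]
          exact Real.rpow_le_rpow hx0 hx.2 hγ.le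
        gcongr
        rw [le_div_iff₀ hγ]
        linarith
    _ ≤ _ := by
        refine setIntegral_mono_set (hint.mono_set hsub0) (ae_of_all _ fun x => ?_)
          hsub.eventuallyLE
        show 0 ≤ _
        positivity

lemma gg_upper (γ c a θ : ℝ) (hγ : 0 < γ) (hc : 0 < c) (ha : 0 < a) (hθ : 0 < θ)
    (hθ1 : θ < 1) :
    ∃ K > 0, ∀ L : ℝ, 0 ≤ L →
      ggSurvival γ c ((γ * a * L) ^ (1/γ)) ≤ K * Real.exp (-((1 - θ) * a) * L) := by
  have hI := (gg_integrable γ hγ (θ/γ) (by positivity)).const_mul c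
  set J := ∫ x in Set.Ici (0:ℝ), c * Real.exp (-(θ/γ) * |x| ^ γ) with hJ
  have hJ0 : 0 ≤ J := setIntegral_nonneg measurableSet_Ici fun x _ => by positivity
  refine ⟨J + 1, by linarith, fun L hL => ?_⟩
  set T := (γ * a * L) ^ (1/γ) with hT
  have hT0 : 0 ≤ T := by positivity
  have hsub0 : Set.Ici T ⊆ Set.Ici 0 := Set.Ici_subset_Ici.2 hT0
  have hint := gg_integrable' γ c hγ
  unfold ggSurvival
  calc ∫ x in Set.Ici T, c * Real.exp (-(|x| ^ γ) / γ)
      ≤ ∫ x in Set.Ici T, (c * Real.exp (-(θ/γ) * |x| ^ γ)) * Real.exp (-((1 - θ) * a) * L) := by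
        refine setIntegral_mono_on (hint.mono_set hsub0)
          ((IntegrableOn.mono_set hI hsub0).mul_const _) measurableSet_Ici ?_
        intro x hx
        have hx0 : 0 ≤ x := hT0.trans hx
        have : γ * a * L ≤ |x| ^ γ := by
          rw [abs_of_nonneg hx0, ← gg_pow γ (γ * a * L) hγ (by positivity)]
          exact Real.rpow_le_rpow hT0 hx hγ.le
        rw [mul_assoc, ← Real.exp_add]
        gcongr
        have h2 : a * L ≤ |x| ^ γ / γ := by
          rw [le_div_iff₀ hγ]; linarith
        have h3 := mul_le_mul_of_nonneg_left h2 (show 0 ≤ 1 - θ by linarith)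
        have e1 : -(|x| ^ γ) / γ = -(|x| ^ γ / γ) := by ring
        have e2 : -(θ/γ) * |x| ^ γ = -θ * (|x| ^ γ / γ) := by ring
        rw [e1, e2]
        linarith
    _ = (∫ x in Set.Ici T, c * Real.exp (-(θ/γ) * |x| ^ γ)) * Real.exp (-((1 - θ) * a) * L) :=
        integral_mul_const _ _
    _ ≤ (J + 1) * Real.exp (-((1 - θ) * a) * L) := by
        gcongr
        refine (setIntegral_mono_set hI (ae_of_all _ fun x => ?_) hsub0.eventuallyLE).trans
          (by linarith)
        show 0 ≤ _
        positivity

lemma gg_main (γ c a : ℝ) (hγ : 0 < γ) (hc : 0 < c) (ha : 0 < a) :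
    Tendsto (fun L : ℝ => Real.log (ggSurvival γ c ((γ * a * L) ^ (1/γ))) / L)
      atTop (𝓝 (-a)) := by
  have hz : ∀ K : ℝ, ∀ d : ℝ, Tendsto (fun L : ℝ => K / L + d) atTop (𝓝 d) := fun K d => by
    simpa using (tendsto_const_nhds.div_atTop tendsto_id).add_const d
  have hev : ∀ᶠ L : ℝ in atTop, 1 ≤ γ * L :=
    (tendsto_id.const_mul_atTop hγ).eventually_ge_atTop 1
  rw [tendsto_order]
  constructor
  · intro b hb
    obtain ⟨K, hK, h⟩ := gg_lower γ c a ((-a - b)/2) hγ hc ha (by linarith)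
    filter_upwards [hev, eventually_gt_atTop 0,
      (hz (Real.log K) (-(a + (-a - b)/2))).eventually_const_lt (show b < _ by linarith)]
      with L h1 h0 h2
    refine h2.trans_le ?_
    have := Real.log_le_log (by positivity) (h L h1)
    rw [Real.log_mul hK.ne' (Real.exp_pos _).ne', Real.log_exp] at this
    rw [le_div_iff₀ h0, add_mul, div_mul_cancel₀ _ h0.ne']
    exact this
  · intro b hb
    obtain ⟨θ, hθ, hθ1, hθb⟩ : ∃ θ : ℝ, 0 < θ ∧ θ < 1 ∧ -((1 - θ) * a) < b := by
      have hp : 0 < (b + a) / a := div_pos (by linarith) ha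
      refine ⟨min (1/2) ((b + a) / a / 2), by positivity, ?_, ?_⟩
      · exact (min_le_left _ _).trans_lt (by norm_num)
      · have h1 : min (1/2) ((b + a) / a / 2) < (b + a) / a :=
          (min_le_right _ _).trans_lt (by linarith)
        rw [lt_div_iff₀ ha] at h1
        linarith
    obtain ⟨K, hK, h⟩ := gg_upper γ c a θ hγ hc ha hθ hθ1
    obtain ⟨K', hK', h'⟩ := gg_lower γ c a 1 hγ hc ha one_pos
    filter_upwards [hev, eventually_gt_atTop 0,
      (hz (Real.log K) (-((1 - θ) * a))).eventually_lt_const hθb]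
      with L h1 h0 h2
    refine lt_of_le_of_lt ?_ h2
    have hpos : 0 < ggSurvival γ c ((γ * a * L) ^ (1/γ)) :=
      lt_of_lt_of_le (by positivity) (h' L h1)
    have := Real.log_le_log hpos (h L h0.le)
    rw [Real.log_mul hK.ne' (Real.exp_pos _).ne', Real.log_exp] at this
    rw [div_le_iff₀ h0, add_mul, div_mul_cancel₀ _ h0.ne']
    exact this

/-- For γ > 0, 0 < r < q, t_n = (γ q log n)^(1/γ) and
μ_n = (γ r log n)^(1/γ), the generalized Gaussian survival function satisfies
log F̄_γ(t_n)/log n → −q and log F̄_γ(t_n − μ_n)/log n → −(q^(1/γ) − r^(1/γ))^γ. -/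
theorem stmt_12 (γ c q r : ℝ) (hγ : 0 < γ) (hc : 0 < c)
    (hnorm : ∫ x : ℝ, c * Real.exp (-(|x| ^ γ) / γ) = 1)
    (hr : 0 < r) (hrq : r < q) :
    Tendsto (fun n : ℕ =>
        Real.log (ggSurvival γ c ((γ * q * Real.log n) ^ (1/γ))) / Real.log n)
      atTop (𝓝 (-q)) ∧
    Tendsto (fun n : ℕ =>
        Real.log (ggSurvival γ c
          ((γ * q * Real.log n) ^ (1/γ) - (γ * r * Real.log n) ^ (1/γ))) / Real.log n)
      atTop (𝓝 (-((q ^ (1/γ) - r ^ (1/γ)) ^ γ))) := by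
  have hL : Tendsto (fun n : ℕ => Real.log (n : ℝ)) atTop atTop :=
    Real.tendsto_log_atTop.comp tendsto_natCast_atTop_atTop
  refine ⟨(gg_main γ c q hγ hc (hr.trans hrq)).comp hL, ?_⟩
  have hd : 0 < q ^ (1/γ) - r ^ (1/γ) :=
    sub_pos.2 (Real.rpow_lt_rpow hr.le hrq (by positivity))
  have hq : 0 < q := hr.trans hrq
  refine ((gg_main γ c _ hγ hc (Real.rpow_pos_of_pos hd γ)).comp hL).congr fun n => ?_
  have hn : 0 ≤ Real.log (n : ℝ) := Real.log_natCast_nonneg n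
  have key : ∀ a : ℝ, 0 ≤ a →
      (γ * a * Real.log n) ^ (1/γ) = (γ * Real.log n) ^ (1/γ) * a ^ (1/γ) := fun a ha => by
    rw [← Real.mul_rpow (by positivity) ha]; congr 1; ring
  show Real.log (ggSurvival γ c _) / _ = _
  rw [key _ (by positivity), key q hq.le, key r hr.le, ← mul_sub, ← Real.rpow_mul hd.le,
    mul_one_div_cancel hγ.ne', Real.rpow_one]
end

section
/- Fix γ > 1 and set r_γ = (1 − 2^{−1/(γ−1)})^γ. Suppose 1/2 < β < 1 − 2^{−γ/(γ−1)} and r satisfies (2^{1/(γ−1)} − 1)^{γ−1}(β − 1/2) < r < r_γ. Then both exponents appearing in the higher criticism analysis are positive: (1 + r/r_γ)/2 − β − r(r_γ^{−1/γ} − 1)^γ > 0 and 1 − β − r(r_γ^{−1/γ} − 1)^γ > 0. -/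
/-- For γ > 1, r_γ = (1 − 2^(−1/(γ−1)))^γ, if
1/2 < β < 1 − 2^(−γ/(γ−1)) and (2^(1/(γ−1)) − 1)^(γ−1) (β − 1/2) < r < r_γ,
then both exponents from the higher criticism analysis are positive. -/
theorem stmt_13 (γ β r : ℝ) (hγ : 1 < γ)
    (hβ : 1/2 < β ∧ β < 1 - (2:ℝ) ^ (-γ/(γ-1)))
    (hr : ((2:ℝ) ^ (1/(γ-1)) - 1) ^ (γ-1) * (β - 1/2) < r ∧
      r < (1 - (2:ℝ) ^ (-1/(γ-1))) ^ γ) :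
    0 < (1 + r / (1 - (2:ℝ) ^ (-1/(γ-1))) ^ γ) / 2 - β -
        r * (((1 - (2:ℝ) ^ (-1/(γ-1))) ^ γ) ^ (-1/γ) - 1) ^ γ ∧
    0 < 1 - β - r * (((1 - (2:ℝ) ^ (-1/(γ-1))) ^ γ) ^ (-1/γ) - 1) ^ γ := by
  obtain ⟨hb1, hb2⟩ := hβ
  obtain ⟨h1, h2⟩ := hr
  have hg : 0 < γ - 1 := by linarith
  have hg0 : 0 < γ := by linarith
  have e1 : (2:ℝ) ^ (-1/(γ-1)) = ((2:ℝ) ^ (1/(γ-1)))⁻¹ := by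
    rw [← Real.rpow_neg (by norm_num)]; congr 1; ring
  have e2 : (2:ℝ) ^ (-γ/(γ-1)) = (2 * (2:ℝ) ^ (1/(γ-1)))⁻¹ := by
    have h : -γ/(γ-1) = -(1 + 1/(γ-1)) := by field_simp; ring
    rw [h, Real.rpow_neg (by norm_num), Real.rpow_add (by norm_num), Real.rpow_one]
  have ha : 1 < (2:ℝ) ^ (1/(γ-1)) := Real.one_lt_rpow (by norm_num) (by positivity)
  have e3 : ((2:ℝ) ^ (1/(γ-1))) ^ γ = 2 * (2:ℝ) ^ (1/(γ-1)) := by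
    rw [← Real.rpow_mul (by norm_num)]
    have h : 1/(γ-1)*γ = 1 + 1/(γ-1) := by field_simp; ring
    rw [h, Real.rpow_add (by norm_num), Real.rpow_one]
  rw [e2] at hb2
  rw [e1] at h2 ⊢
  generalize (2:ℝ) ^ (1/(γ-1)) = a at *
  have hs : 0 < a - 1 := by linarith
  have ha0 : 0 < a := by linarith
  have hx : 1 - a⁻¹ = (a - 1) / a := by field_simp
  have hxp : 0 < (a - 1) / a := by positivity
  have e4 : (((a - 1) / a) ^ γ) ^ (-1/γ) - 1 = (a - 1)⁻¹ := by
    rw [← Real.rpow_mul hxp.le]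
    have h : γ * (-1/γ) = -1 := by field_simp
    rw [h, Real.rpow_neg_one]; field_simp; ring
  have e5 : (a - 1) ^ γ = (a - 1) ^ (γ - 1) * (a - 1) := by
    rw [← Real.rpow_add_one hs.ne']; congr 1; ring
  rw [hx] at h2 ⊢
  rw [e4, Real.inv_rpow hs.le]
  rw [Real.div_rpow hs.le ha0.le, e3, e5] at h2 ⊢
  have hD : 0 < (a - 1) ^ (γ - 1) := Real.rpow_pos_of_pos hs _
  generalize (a - 1) ^ (γ - 1) = D at *
  constructor
  · have h : (1 + r / (D * (a - 1) / (2 * a))) / 2 - β - r * (D * (a - 1))⁻¹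
        = r / D - (β - 1/2) := by field_simp; ring
    rw [h, sub_pos, lt_div_iff₀ hD]; linarith
  · have h : r * (D * (a - 1))⁻¹ < (2 * a)⁻¹ := by
      have hC : 0 < D * (a - 1) := by positivity
      rw [← div_eq_mul_inv, div_lt_iff₀ hC]
      rw [div_eq_inv_mul] at h2; exact h2
    linarith
end
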